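/- arXiv:1708.02055 — 4 statements merged into one kernel-verified Lean document; each statement's English description precedes it below -/
import Mathlib

section
/- Let P be a finite graded poset and Q ⊆ P a closed subposet (x ≤ y and y ∈ Q imply x ∈ Q). Let V_Q be a discrete vector field on Q and V_{P∖Q} a discrete vector field on P∖Q. Then every cycle of V = V_Q ∪ V_{P∖Q} is contained either entirely in Q or entirely in P∖Q. In particular, if both V_Q and V_{P∖Q} are gradient fields, then V is a gradient field on P. -/
section DVF

variable {P : Type*} [PartialOrder P]

/-- `a` is a facet of `b` with respect to the grading `d`. -/
def IsFacet (d : P → ℕ) (a b : P) : Prop := a < b ∧ d b = d a + 1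

/-- A discrete vector field: a set of pairwise disjoint facet pairs. -/
def IsDVF (d : P → ℕ) (V : Set (P × P)) : Prop :=
  (∀ p ∈ V, IsFacet d p.1 p.2) ∧
    ∀ p ∈ V, ∀ q ∈ V, p ≠ q →
      p.1 ≠ q.1 ∧ p.1 ≠ q.2 ∧ p.2 ≠ q.1 ∧ p.2 ≠ q.2

/-- A cycle `(a₁,b₁,a₂,b₂,…,a_k,b_k,a_{k+1}=a₁)` of a discrete vector field. -/
def IsCycle (d : P → ℕ) (V : Set (P × P)) (k : ℕ)
    (a : Fin (k + 1) → P) (b : Fin k → P) : Prop :=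
  0 < k ∧ a 0 = a (Fin.last k) ∧
    ∀ i : Fin k,
      (a i.castSucc, b i) ∈ V ∧ (a i.succ, b i) ∉ V ∧ IsFacet d (a i.succ) (b i)

/-- A discrete vector field is a gradient field if it admits no cycle. -/
def IsGradient (d : P → ℕ) (V : Set (P × P)) : Prop :=
  ∀ (k : ℕ) (a : Fin (k + 1) → P) (b : Fin k → P), ¬ IsCycle d V k a b

/-- The critical cells of a discrete vector field: cells occurring in no pair. -/
def Crit (V : Set (P × P)) : Set P := {x | ∀ p ∈ V, p.1 ≠ x ∧ p.2 ≠ x}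

end DVF

/-- A cycle of a larger set of pairs is a cycle of any subset containing all its pairs. -/
theorem IsCycle.of_subset {P : Type*} [PartialOrder P] {d : P → ℕ} {V W : Set (P × P)} {k : ℕ}
    {a : Fin (k + 1) → P} {b : Fin k → P} (h : IsCycle d V k a b) (hWV : W ⊆ V)
    (hW : ∀ i : Fin k, (a i.castSucc, b i) ∈ W) : IsCycle d W k a b :=
  ⟨h.1, h.2.1, fun i => ⟨hW i, fun hi => (h.2.2 i).2.1 (hWV hi), (h.2.2 i).2.2⟩⟩

/-- A cycle whose pairs do not cross the boundary of a lower set `Q` lies in `Q` or in its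
complement. -/
theorem IsCycle.mem_or_notMem {P : Type*} [PartialOrder P] {d : P → ℕ} {V : Set (P × P)} {Q : Set P}
    {k : ℕ} {a : Fin (k + 1) → P} {b : Fin k → P} (h : IsCycle d V k a b)
    (hQ : ∀ x y : P, x ≤ y → y ∈ Q → x ∈ Q) (hV : ∀ p ∈ V, p.1 ∈ Q ↔ p.2 ∈ Q) :
    ((∀ i, a i ∈ Q) ∧ ∀ i, b i ∈ Q) ∨ ((∀ i, a i ∉ Q) ∧ ∀ i, b i ∉ Q) := by
  have hab (i : Fin k) : a i.castSucc ∈ Q ↔ b i ∈ Q := hV _ (h.2.2 i).1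
  have hmono : Monotone fun i => a i ∈ Q :=
    Fin.monotone_iff_le_succ.2 fun i hi => hQ _ _ (h.2.2 i).2.2.1.le ((hab i).1 hi)
  by_cases h0 : a 0 ∈ Q
  · have ha (i) : a i ∈ Q := hmono (Fin.zero_le i) h0
    exact .inl ⟨ha, fun i => (hab i).1 (ha _)⟩
  · have ha (i) : a i ∉ Q := fun hi => h0 (h.2.1 ▸ hmono (Fin.le_last i) hi)
    exact .inr ⟨ha, fun i hi => ha _ ((hab i).2 hi)⟩

/-- If `Q` is a closed subposet of a finite graded poset `P`, `V_Q`
is a discrete vector field on `Q` and `V_{P∖Q}` one on `P∖Q`, then every cycle of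
`V_Q ∪ V_{P∖Q}` is contained entirely in `Q` or entirely in `P∖Q`; in particular, if
both are gradient fields then so is their union. -/
theorem stmt_1 {P : Type*} [PartialOrder P] [Fintype P] (d : P → ℕ)
    (Q : Set P) (hQ : ∀ x y : P, x ≤ y → y ∈ Q → x ∈ Q)
    (VQ VC : Set (P × P)) (hVQ : IsDVF d VQ) (hVC : IsDVF d VC)
    (hVQmem : ∀ p ∈ VQ, p.1 ∈ Q ∧ p.2 ∈ Q)
    (hVCmem : ∀ p ∈ VC, p.1 ∉ Q ∧ p.2 ∉ Q) :
    (∀ (k : ℕ) (a : Fin (k + 1) → P) (b : Fin k → P),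
        IsCycle d (VQ ∪ VC) k a b →
          ((∀ i, a i ∈ Q) ∧ ∀ i, b i ∈ Q) ∨ ((∀ i, a i ∉ Q) ∧ ∀ i, b i ∉ Q)) ∧
      (IsGradient d VQ → IsGradient d VC → IsGradient d (VQ ∪ VC)) := by
  have key : ∀ (k : ℕ) (a : Fin (k + 1) → P) (b : Fin k → P),
      IsCycle d (VQ ∪ VC) k a b →
        ((∀ i, a i ∈ Q) ∧ ∀ i, b i ∈ Q) ∨ ((∀ i, a i ∉ Q) ∧ ∀ i, b i ∉ Q) := by
    intro k a b h
    refine h.mem_or_notMem hQ ?_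
    rintro p (hp | hp)
    · exact iff_of_true (hVQmem p hp).1 (hVQmem p hp).2
    · exact iff_of_false (hVCmem p hp).1 (hVCmem p hp).2
  refine ⟨key, fun hGQ hGC k a b h => ?_⟩
  obtain ⟨ha, -⟩ | ⟨ha, -⟩ := key k a b h
  · exact hGQ k a b <| h.of_subset Set.subset_union_left fun i =>
      (h.2.2 i).1.resolve_right fun hi => (hVCmem _ hi).1 (ha _)
  · exact hGC k a b <| h.of_subset Set.subset_union_right fun i =>
      (h.2.2 i).1.resolve_left fun hi => ha _ (hVQmem _ hi).1
end

section
/- Let P and Q be finite posets with strictly monotone gradings (a < b implies d(a) < d(b)), and let V and W be gradient fields on P and Q respectively. Give P × Q the componentwise order and the grading d(p,q) = d(p) + d(q). Then the discrete vector field V × W := {((p,q),(p,q')) : p ∈ P, (q,q') ∈ W} ∪ {((p,q),(p',q)) : (p,p') ∈ V, q ∈ Crit(W)} is a gradient field on P × Q, and Crit(V × W) = Crit(V) × Crit(W). -/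
section Flow

variable {P : Type*}

/-- The lower cells of the pairs of `V`. -/
def IsSource (V : Set (P × P)) (a : P) : Prop := ∃ b, (a, b) ∈ V

/-- The upper cells of the pairs of `V`. -/
def IsTarget (V : Set (P × P)) (b : P) : Prop := ∃ a, (a, b) ∈ V

theorem mem_crit_iff {V : Set (P × P)} {x : P} :
    x ∈ Crit V ↔ ¬ IsSource V x ∧ ¬ IsTarget V x := by
  constructor
  · exact fun h => ⟨fun ⟨b, hb⟩ => (h _ hb).1 rfl, fun ⟨a, ha⟩ => (h _ ha).2 rfl⟩
  · rintro ⟨h₁, h₂⟩ ⟨a, b⟩ hab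
    exact ⟨fun h => h₁ ⟨b, h ▸ hab⟩, fun h => h₂ ⟨a, h ▸ hab⟩⟩

variable [PartialOrder P]

/-- One step `a, b, a'` of a flow, seen as a relation between `a` and `a'`. -/
def FlowStep (d : P → ℕ) (V : Set (P × P)) (a a' : P) : Prop :=
  ∃ b, (a, b) ∈ V ∧ (a', b) ∉ V ∧ IsFacet d a' b

theorem IsDVF.not_isTarget_of_isSource {d : P → ℕ} {V : Set (P × P)} (hV : IsDVF d V) {x : P}
    (hs : IsSource V x) : ¬ IsTarget V x := by
  rintro ⟨a, ha⟩
  obtain ⟨b, hb⟩ := hs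
  by_cases h : (x, b) = (a, x)
  · obtain ⟨-, rfl⟩ := Prod.mk.inj h
    exact (hV.1 _ hb).1.ne rfl
  · exact (hV.2 _ hb _ ha h).2.1 rfl

theorem exists_path_of_transGen {α : Type*} {r : α → α → Prop} {x y : α}
    (h : Relation.TransGen r x y) :
    ∃ (k : ℕ) (f : ℕ → α), 0 < k ∧ f 0 = x ∧ f k = y ∧ ∀ i < k, r (f i) (f (i + 1)) := by
  induction h using Relation.TransGen.head_induction_on with
  | @single a h =>
    refine ⟨1, fun n => Nat.casesOn n a fun _ => y, one_pos, rfl, rfl, fun i hi => ?_⟩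
    obtain rfl : i = 0 := by omega
    exact h
  | @head a c h _ ih =>
    obtain ⟨k, f, -, rfl, hk, hf⟩ := ih
    refine ⟨k + 1, fun n => Nat.casesOn n a f, k.succ_pos, rfl, hk, fun i hi => ?_⟩
    cases i with
    | zero => exact h
    | succ i => exact hf i (by omega)

theorem IsGradient.not_transGen_flowStep {d : P → ℕ} {V : Set (P × P)} (hV : IsGradient d V)
    (x : P) : ¬ Relation.TransGen (FlowStep d V) x x := by
  intro h
  obtain ⟨k, f, hk, h0, hfk, hf⟩ := exists_path_of_transGen h
  choose b hb using fun i : Fin k => hf i i.2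
  exact hV k (fun i => f i) b ⟨hk, by simp [h0, hfk], fun i => by simpa using hb i⟩

/-- A cycle passes only through sources. -/
theorem IsCycle.exists_transGen {d : P → ℕ} {V : Set (P × P)} {k : ℕ} {a : Fin (k + 1) → P}
    {b : Fin k → P} (h : IsCycle d V k a b) :
    ∃ x, Relation.TransGen (fun y z => FlowStep d V y z ∧ IsSource V z) x x := by
  obtain ⟨hk, h0, hs⟩ := h
  have hlive : ∀ j, IsSource V (a j) := by
    refine Fin.lastCases ?_ fun i => ⟨_, (hs i).1⟩
    rw [← h0]
    exact ⟨_, (hs ⟨0, hk⟩).1⟩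
  have hpath : ∀ n (hn : n < k), Relation.TransGen
      (fun y z => FlowStep d V y z ∧ IsSource V z) (a 0) (a (Fin.succ ⟨n, hn⟩)) := by
    intro n
    induction n with
    | zero => exact fun hn => .single ⟨⟨_, hs ⟨0, hn⟩⟩, hlive _⟩
    | succ n ih => exact fun hn => .tail (ih (by omega)) ⟨⟨_, hs ⟨n + 1, hn⟩⟩, hlive _⟩
  refine ⟨a 0, ?_⟩
  have hlast := hpath (k - 1) (by omega)
  rwa [show Fin.succ ⟨k - 1, by omega⟩ = Fin.last k from Fin.ext (by simp; omega), ← h0] at hlast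

end Flow

section Product

variable {P Q : Type*}

/-- The product of two discrete vector fields. -/
def prodField (V : Set (P × P)) (W : Set (Q × Q)) : Set ((P × Q) × (P × Q)) :=
  {x | ∃ p q q', (q, q') ∈ W ∧ x = ((p, q), (p, q'))} ∪
    {x | ∃ p p' q, (p, p') ∈ V ∧ q ∈ Crit W ∧ x = ((p, q), (p', q))}

theorem mem_prodField {V : Set (P × P)} {W : Set (Q × Q)} {p p' : P} {q q' : Q} :
    ((p, q), (p', q')) ∈ prodField V W ↔
      (p' = p ∧ (q, q') ∈ W) ∨ (q' = q ∧ (p, p') ∈ V ∧ q ∈ Crit W) := by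
  simp only [prodField, Set.mem_union, Set.mem_ofPred_eq, Prod.mk.injEq]
  constructor
  · rintro (⟨_, _, _, h, ⟨rfl, rfl⟩, rfl, rfl⟩ | ⟨_, _, _, h, hq, ⟨rfl, rfl⟩, rfl, rfl⟩)
    · exact .inl ⟨rfl, h⟩
    · exact .inr ⟨rfl, h, hq⟩
  · rintro (⟨rfl, h⟩ | ⟨rfl, h, hq⟩)
    · exact .inl ⟨_, _, _, h, ⟨rfl, rfl⟩, rfl, rfl⟩
    · exact .inr ⟨_, _, _, h, hq, ⟨rfl, rfl⟩, rfl, rfl⟩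

theorem isSource_prodField {V : Set (P × P)} {W : Set (Q × Q)} {p : P} {q : Q} :
    IsSource (prodField V W) (p, q) ↔ IsSource W q ∨ (IsSource V p ∧ q ∈ Crit W) := by
  simp only [IsSource, Prod.exists, mem_prodField]
  aesop

theorem isTarget_prodField {V : Set (P × P)} {W : Set (Q × Q)} {p : P} {q : Q} :
    IsTarget (prodField V W) (p, q) ↔ IsTarget W q ∨ (IsTarget V p ∧ q ∈ Crit W) := by
  simp only [IsTarget, Prod.exists, mem_prodField]
  aesop

theorem crit_prodField (V : Set (P × P)) (W : Set (Q × Q)) :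
    Crit (prodField V W) = {y : P × Q | y.1 ∈ Crit V ∧ y.2 ∈ Crit W} := by
  ext ⟨p, q⟩
  simp only [Set.mem_ofPred_eq, mem_crit_iff, isSource_prodField, isTarget_prodField]
  tauto

variable [PartialOrder P] [PartialOrder Q]

theorem IsFacet.of_prod {dP : P → ℕ} {dQ : Q → ℕ} (hdP : StrictMono dP) (hdQ : StrictMono dQ)
    {p p' : P} {q q' : Q} (h : IsFacet (fun y : P × Q => dP y.1 + dQ y.2) (p, q) (p', q')) :
    (p = p' ∧ IsFacet dQ q q') ∨ (q = q' ∧ IsFacet dP p p') := by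
  obtain ⟨hlt, hd⟩ := h
  obtain ⟨hp, hq⟩ := Prod.mk_le_mk.1 hlt.le
  simp only at hd
  rcases hp.eq_or_lt with rfl | hp
  · rcases hq.eq_or_lt with rfl | hq
    · exact (lt_irrefl _ hlt).elim
    · exact .inl ⟨rfl, hq, by omega⟩
  · rcases hq.eq_or_lt with rfl | hq
    · exact .inr ⟨rfl, hp, by omega⟩
    · have := hdP hp
      have := hdQ hq
      omega

/-- A flow step in a product that ends in a source is a step in one of the factors, or moves
from a source to a target in the first factor. -/
theorem FlowStep.of_prod {dP : P → ℕ} {dQ : Q → ℕ} (hdP : StrictMono dP) (hdQ : StrictMono dQ)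
    {V : Set (P × P)} {W : Set (Q × Q)} (hW : IsDVF dQ W) {y z : P × Q}
    (h : FlowStep (fun y : P × Q => dP y.1 + dQ y.2) (prodField V W) y z)
    (hz : IsSource (prodField V W) z) :
    (z.1 = y.1 ∧ IsSource W y.2 ∧ FlowStep dQ W y.2 z.2) ∨
      (z.2 = y.2 ∧ y.2 ∈ Crit W ∧ IsSource V y.1 ∧ FlowStep dP V y.1 z.1) ∨
      (y.2 ∈ Crit W ∧ IsSource V y.1 ∧ IsTarget V z.1) := by
  obtain ⟨p, q⟩ := y
  obtain ⟨p', q'⟩ := z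
  obtain ⟨⟨p₁, q₁⟩, hmem, hnot, hf⟩ := h
  rw [mem_prodField] at hmem hnot
  rw [isSource_prodField] at hz
  rcases hmem with ⟨rfl, hmem⟩ | ⟨rfl, hmem, hc⟩
  · rcases hf.of_prod hdP hdQ with ⟨rfl, hf₁⟩ | ⟨rfl, -⟩
    · exact .inl ⟨rfl, ⟨_, hmem⟩, _, hmem, fun h => hnot (.inl ⟨rfl, h⟩), hf₁⟩
    · have ht : IsTarget W q' := ⟨_, hmem⟩
      rcases hz with hz | ⟨-, hz⟩
      · exact (hW.not_isTarget_of_isSource hz ht).elim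
      · exact ((mem_crit_iff.1 hz).2 ht).elim
  · rcases hf.of_prod hdP hdQ with ⟨rfl, -⟩ | ⟨rfl, hf₁⟩
    · exact .inr (.inr ⟨hc, ⟨_, hmem⟩, _, hmem⟩)
    · exact .inr (.inl ⟨rfl, hc, ⟨_, hmem⟩, _, hmem, fun h => hnot (.inr ⟨rfl, h, hc⟩), hf₁⟩)

theorem isGradient_prodField {dP : P → ℕ} {dQ : Q → ℕ} (hdP : StrictMono dP)
    (hdQ : StrictMono dQ) {V : Set (P × P)} {W : Set (Q × Q)} (hV : IsDVF dP V)
    (hW : IsDVF dQ W) (hVg : IsGradient dP V) (hWg : IsGradient dQ W) :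
    IsGradient (fun y : P × Q => dP y.1 + dQ y.2) (prodField V W) := by
  intro k a b hcyc
  obtain ⟨x, hx⟩ := hcyc.exists_transGen
  have hsrc : ∀ {u}, IsSource V u → ¬ IsTarget V u := hV.not_isTarget_of_isSource
  have key : ∀ y, Relation.TransGen (fun y z =>
        FlowStep (fun y : P × Q => dP y.1 + dQ y.2) (prodField V W) y z ∧
          IsSource (prodField V W) z) x y →
      (IsTarget V y.1 ∧ ¬ IsTarget V x.1) ∨
      (y.1 = x.1 ∧ IsSource W x.2 ∧ Relation.TransGen (FlowStep dQ W) x.2 y.2) ∨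
      (¬ IsTarget V x.1 ∧ y.2 ∈ Crit W ∧
        (x.2 ∈ Crit W → y.2 = x.2 ∧ Relation.TransGen (FlowStep dP V) x.1 y.1)) := by
    intro y hy
    induction hy with
    | single h =>
      rcases h.1.of_prod hdP hdQ hW h.2 with ⟨h₁, hs, h₂⟩ | ⟨h₁, hc, hs, h₂⟩ | ⟨hc, hs, ht⟩
      · exact .inr (.inl ⟨h₁, hs, .single h₂⟩)
      · exact .inr (.inr ⟨hsrc hs, h₁ ▸ hc, fun _ => ⟨h₁, .single h₂⟩⟩)
      · exact .inl ⟨ht, hsrc hs⟩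
    | tail _ h ih =>
      rcases h.1.of_prod hdP hdQ hW h.2 with ⟨h₁, hs, h₂⟩ | ⟨h₁, hc, hs, h₂⟩ | ⟨hc, hs, ht⟩
      · rcases ih with ⟨hy, hx⟩ | ⟨hy, hx, hg⟩ | ⟨-, hy, -⟩
        · exact .inl ⟨h₁ ▸ hy, hx⟩
        · exact .inr (.inl ⟨h₁.trans hy, hx, hg.tail h₂⟩)
        · exact ((mem_crit_iff.1 hy).1 hs).elim
      · rcases ih with ⟨hy, -⟩ | ⟨hy, hx, -⟩ | ⟨hx, -, hg⟩
        · exact (hsrc hs hy).elim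
        · exact .inr (.inr ⟨hy ▸ hsrc hs, h₁ ▸ hc, fun hxc => ((mem_crit_iff.1 hxc).1 hx).elim⟩)
        · exact .inr (.inr ⟨hx, h₁ ▸ hc,
            fun hxc => ⟨h₁.trans (hg hxc).1, (hg hxc).2.tail h₂⟩⟩)
      · rcases ih with ⟨hy, -⟩ | ⟨hy, -, -⟩ | ⟨hx, -, -⟩
        · exact (hsrc hs hy).elim
        · exact .inl ⟨ht, hy ▸ hsrc hs⟩
        · exact .inl ⟨ht, hx⟩
  rcases key x hx with ⟨h, h'⟩ | ⟨-, -, h⟩ | ⟨-, hc, h⟩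
  · exact h' h
  · exact hWg.not_transGen_flowStep _ h
  · exact hVg.not_transGen_flowStep _ (h hc).2

end Product

/-- The product of two gradient fields is a gradient field on the
product poset (with componentwise order and grading `d(p,q) = d(p) + d(q)`), and its
critical cells are the products of critical cells. -/
theorem stmt_3 {P Q : Type*} [PartialOrder P] [PartialOrder Q] [Fintype P] [Fintype Q]
    (dP : P → ℕ) (dQ : Q → ℕ)
    (hdP : ∀ a b : P, a < b → dP a < dP b)
    (hdQ : ∀ a b : Q, a < b → dQ a < dQ b)
    (V : Set (P × P)) (W : Set (Q × Q))
    (hV : IsDVF dP V) (hW : IsDVF dQ W)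
    (hVg : IsGradient dP V) (hWg : IsGradient dQ W) :
    let VW : Set ((P × Q) × (P × Q)) :=
      {x | ∃ p q q', (q, q') ∈ W ∧ x = ((p, q), (p, q'))} ∪
        {x | ∃ p p' q, (p, p') ∈ V ∧ q ∈ Crit W ∧ x = ((p, q), (p', q))}
    IsGradient (fun y : P × Q => dP y.1 + dQ y.2) VW ∧
      Crit VW = {y : P × Q | y.1 ∈ Crit V ∧ y.2 ∈ Crit W} := by
  exact ⟨isGradient_prodField (fun a b => hdP a b) (fun a b => hdQ a b) hV hW hVg hWg,
    crit_prodField V W⟩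
end

section
/- Let K be an A-cubical complex, let A = C ⊔ B_1 ⊔ … ⊔ B_k ⊔ D be a partition of A into pairwise disjoint subsets with each B_i nonempty, and let λ be an ordered partition of C and μ an ordered partition of D. Then the following are equivalent: (a) the concatenated ordered partition λ|B_1|…|B_k|μ belongs to P_K; (b) λ ∈ P_{K|^0_C}, μ ∈ P_{K|^1_D}, and c(C∪B_1∪…∪B_{i−1}, B_i, B_{i+1}∪…∪B_k∪D) ∈ K for every i ∈ {1,…,k}. -/
section Core

variable {A : Type*} [DecidableEq A] [Fintype A]

/-- A cube of the standard `A`-cube: `none` means `*`, `some true` means `1`,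
`some false` means `0`. -/
abbrev Cube (A : Type*) := A → Option Bool

/-- The cube `c(O, S, rest)` with value `1` on `O`, `*` on `S` and `0` elsewhere. -/
def cubeOn (O S : Finset A) : Cube A := fun a =>
  if a ∈ S then none else if a ∈ O then some true else some false

/-- An `A`-cubical complex: a set of cubes closed under the face maps, i.e. under
replacing any occurrence of `*` by `0` or `1`. -/
def IsComplex (K : Set (Cube A)) : Prop :=
  ∀ c ∈ K, ∀ a : A, c a = none → ∀ ε : Bool, Function.update c a (some ε) ∈ K

/-- Union of the blocks of a list of finsets. -/
def blocksUnion (L : List (Finset A)) : Finset A := L.foldr (· ∪ ·) ∅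

/-- `L` is an ordered partition of `S`: a sequence of nonempty pairwise disjoint
subsets whose union is `S`. -/
def IsOPart (S : Finset A) (L : List (Finset A)) : Prop :=
  (∀ B ∈ L, B.Nonempty) ∧
    List.Pairwise (fun B C : Finset A => Disjoint B C) L ∧ blocksUnion L = S

/-- The set `P_K` of ordered partitions `L = B₁|…|B_l` of `S` such that each cube
`c((O ∪ B₁∪…∪B_{i-1}), B_i, rest)` belongs to `K`.  Here `O` records the part of the
ambient set on which the cubes take the fixed value `1` (used for the restrictions
`K|_B^ε`); for the full complex take `O = ∅`, `S = univ`. -/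
def PK (K : Set (Cube A)) (O S : Finset A) : Set (List (Finset A)) :=
  {L | IsOPart S L ∧ ∀ (i : ℕ) (h : i < L.length),
    cubeOn (O ∪ blocksUnion (L.take i)) (L[i]'h) ∈ K}

/-- `x` refines `y`: the blocks of `y` are obtained by uniting consecutive blocks of `x`. -/
def Refines (x y : List (Finset A)) : Prop :=
  ∃ LL : List (List (Finset A)), (∀ l ∈ LL, l ≠ []) ∧
    x = LL.flatten ∧ y = LL.map blocksUnion

/-- Dimension of an ordered partition: `Σ (#Bᵢ - 1)`. -/
def pdim (L : List (Finset A)) : ℕ := (L.map fun B => B.card - 1).sum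

/-- The facet relation on ordered partitions. -/
def PFacet (x y : List (Finset A)) : Prop :=
  Refines x y ∧ x ≠ y ∧ pdim y = pdim x + 1

/-- A cycle of a discrete vector field on a poset of ordered partitions. -/
def PCycle (V : Set (List (Finset A) × List (Finset A))) (k : ℕ)
    (a : Fin (k + 1) → List (Finset A)) (b : Fin k → List (Finset A)) : Prop :=
  0 < k ∧ a 0 = a (Fin.last k) ∧
    ∀ i : Fin k, (a i.castSucc, b i) ∈ V ∧ (a i.succ, b i) ∉ V ∧ PFacet (a i.succ) (b i)

/-- A discrete vector field on ordered partitions is a gradient field if it has no cycle. -/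
def PGradient (V : Set (List (Finset A) × List (Finset A))) : Prop :=
  ∀ k a b, ¬ PCycle V k a b

/-- Critical cells of a discrete vector field `V` on the set of cells `S`. -/
def CritOn (S : Set (List (Finset A)))
    (V : Set (List (Finset A) × List (Finset A))) : Set (List (Finset A)) :=
  {x | x ∈ S ∧ ∀ p ∈ V, p.1 ≠ x ∧ p.2 ≠ x}

end Core

section Concatenation

variable {A : Type*} [DecidableEq A]

theorem blocksUnion_append (L M : List (Finset A)) :
    blocksUnion (L ++ M) = blocksUnion L ∪ blocksUnion M := by
  induction L with
  | nil => simp [blocksUnion]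
  | cons B L ih =>
    simp only [blocksUnion, List.cons_append, List.foldr_cons] at ih ⊢
    rw [ih, Finset.union_assoc]

theorem mem_blocksUnion {L : List (Finset A)} {a : A} :
    a ∈ blocksUnion L ↔ ∃ B ∈ L, a ∈ B := by
  induction L with
  | nil => simp [blocksUnion]
  | cons B L ih =>
    simp only [blocksUnion, List.foldr_cons, Finset.mem_union] at ih ⊢
    simp [ih]

theorem disjoint_blocksUnion_right {S : Finset A} {L : List (Finset A)} :
    Disjoint S (blocksUnion L) ↔ ∀ B ∈ L, Disjoint S B := by
  simp only [Finset.disjoint_left, mem_blocksUnion]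
  grind

theorem IsOPart.append {S T : Finset A} {L M : List (Finset A)}
    (hL : IsOPart S L) (hM : IsOPart T M) (h : Disjoint S T) :
    IsOPart (S ∪ T) (L ++ M) := by
  obtain ⟨neL, pwL, rfl⟩ := hL
  obtain ⟨neM, pwM, rfl⟩ := hM
  refine ⟨fun B hB => ?_, List.pairwise_append.2 ⟨pwL, pwM, fun X hX Y hY => ?_⟩,
    blocksUnion_append L M⟩
  · exact (List.mem_append.1 hB).elim (neL B) (neM B)
  · exact (disjoint_blocksUnion_right.1
      (disjoint_blocksUnion_right.1 h Y hY).symm X hX).symm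

/-- The cubes of a concatenation are those of its first part, together with those of its
second part taken over the union of the first. -/
theorem forall_cubeOn_append_iff (K : Set (Cube A)) (O : Finset A) (L M : List (Finset A)) :
    (∀ (i : ℕ) (h : i < (L ++ M).length),
      cubeOn (O ∪ blocksUnion ((L ++ M).take i)) ((L ++ M)[i]'h) ∈ K) ↔
    (∀ (i : ℕ) (h : i < L.length),
      cubeOn (O ∪ blocksUnion (L.take i)) (L[i]'h) ∈ K) ∧
    (∀ (i : ℕ) (h : i < M.length),
      cubeOn (O ∪ blocksUnion L ∪ blocksUnion (M.take i)) (M[i]'h) ∈ K) := by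
  constructor
  · refine fun H => ⟨fun i h => ?_, fun i h => ?_⟩
    · have := H i (by rw [List.length_append]; omega)
      rwa [List.getElem_append_left h, List.take_append_of_le_length h.le] at this
    · have := H (L.length + i) (by rw [List.length_append]; omega)
      rw [List.getElem_append_right (Nat.le_add_right _ _), List.take_length_add_append,
        blocksUnion_append, ← Finset.union_assoc] at this
      simpa using this
  · rintro ⟨HL, HM⟩ i h
    rcases lt_or_ge i L.length with hi | hi
    · rw [List.getElem_append_left hi, List.take_append_of_le_length hi.le]
      exact HL i hi
    · obtain ⟨j, rfl⟩ := Nat.exists_eq_add_of_le hi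
      rw [List.getElem_append_right hi, List.take_length_add_append,
        blocksUnion_append, ← Finset.union_assoc]
      simpa using HM j (by rw [List.length_append] at h; omega)

end Concatenation

/-- For an `A`-cubical complex `K`, a partition
`A = C ⊔ B₁ ⊔ … ⊔ B_k ⊔ D` with all `Bᵢ` nonempty, and ordered partitions `π` of `C`
and `μ` of `D`, the concatenation `π|B₁|…|B_k|μ` belongs to `P_K` iff `π ∈ P_{K|⁰_C}`,
`μ ∈ P_{K|¹_D}` and `c(C∪B₁∪…∪B_{i-1}, B_i, B_{i+1}∪…∪B_k∪D) ∈ K` for all `i`. -/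
theorem stmt_5 {A : Type*} [LinearOrder A] [Fintype A]
    (K : Set (Cube A)) (hK : IsComplex K)
    (C D : Finset A) (Bs : List (Finset A))
    (hBs : ∀ B ∈ Bs, B.Nonempty)
    (hdisj : List.Pairwise (fun X Y : Finset A => Disjoint X Y) (C :: (Bs ++ [D])))
    (hcover : blocksUnion (C :: (Bs ++ [D])) = Finset.univ)
    (π μ : List (Finset A)) (hπ : IsOPart C π) (hμ : IsOPart D μ) :
    π ++ Bs ++ μ ∈ PK K ∅ Finset.univ ↔
      π ∈ PK K ∅ C ∧ μ ∈ PK K (Finset.univ \ D) D ∧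
        ∀ (i : ℕ) (h : i < Bs.length),
          cubeOn (C ∪ blocksUnion (Bs.take i)) (Bs[i]'h) ∈ K := by
  obtain ⟨hC, hBD⟩ := List.pairwise_cons.1 hdisj
  obtain ⟨hBB, -, hBD⟩ := List.pairwise_append.1 hBD
  have hCB : Disjoint C (blocksUnion Bs) :=
    disjoint_blocksUnion_right.2 fun B hB => hC B (by simp [hB])
  have hCBD : Disjoint (C ∪ blocksUnion Bs) D :=
    Finset.disjoint_union_left.2 ⟨hC D (by simp),
      (disjoint_blocksUnion_right.2 fun B hB => (hBD B hB D (by simp)).symm).symm⟩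
  have hU : C ∪ blocksUnion Bs ∪ D = Finset.univ := by
    rw [← hcover, ← List.singleton_append, blocksUnion_append, blocksUnion_append]
    simp [blocksUnion]
  have hD : Finset.univ \ D = C ∪ blocksUnion Bs := by
    rw [← hU, Finset.union_sdiff_cancel_right hCBD]
  have hpart : IsOPart Finset.univ (π ++ Bs ++ μ) :=
    hU ▸ (hπ.append ⟨hBs, hBB, rfl⟩ hCB).append hμ hCBD
  simp only [PK, Set.mem_ofPred_eq, hpart, hπ, hμ, true_and, hD]
  rw [forall_cubeOn_append_iff, forall_cubeOn_append_iff, blocksUnion_append, hπ.2.2,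
    Finset.empty_union, Finset.empty_union, and_assoc, and_congr_right_iff]
  exact fun _ => and_comm
end

section
/- For every finite linearly ordered set A, the discrete vector field V_A is a gradient field on the poset P_A of ordered partitions of A. -/
section MemV

variable {A : Type*} [LinearOrder A] [Fintype A]

/-- The inductively defined standard gradient field `V_S` on ordered partitions of a
finite subset `S` of a linear order: `V_∅ = ∅`, and for nonempty `S` with maximum `m`,
`V_S = V_{S'}|m ∪ V^r_S` where `V^r_S = {(π|m|B|ρ, π|(B∪{m})|ρ)}`. -/
inductive memV : Finset A → List (Finset A) → List (Finset A) → Prop where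
  | mstep (S : Finset A) (hS : S.Nonempty) (x y : List (Finset A)) :
      memV (S.erase (S.max' hS)) x y →
      memV S (x ++ [({S.max' hS} : Finset A)]) (y ++ [({S.max' hS} : Finset A)])
  | rstep (S : Finset A) (hS : S.Nonempty) (C B D : Finset A)
      (π ρ : List (Finset A)) (hB : B.Nonempty)
      (hCB : Disjoint C B) (hCD : Disjoint C D) (hBD : Disjoint B D)
      (hU : C ∪ B ∪ D = S.erase (S.max' hS))
      (hπ : IsOPart C π) (hρ : IsOPart D ρ) :
      memV S (π ++ [({S.max' hS} : Finset A)] ++ [B] ++ ρ)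
        (π ++ [insert (S.max' hS) B] ++ ρ)

end MemV

theorem length_le_length_flatten {α : Type*} {LL : List (List α)}
    (hne : ∀ l ∈ LL, l ≠ []) :
    LL.length ≤ LL.flatten.length := by
  induction LL with
  | nil => simp
  | cons l LL ih =>
    have h1 := List.length_pos_iff.2 (hne l List.mem_cons_self)
    have h2 := ih fun l' hl' => hne l' (List.mem_cons_of_mem _ hl')
    simp only [List.flatten_cons, List.length_append, List.length_cons]
    omega

section BlocksUnion

variable {A : Type*} [DecidableEq A]

theorem blocksUnion_cons (B : Finset A) (L : List (Finset A)) :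
    blocksUnion (B :: L) = B ∪ blocksUnion L := rfl

theorem blocksUnion_singleton (B : Finset A) : blocksUnion [B] = B := by
  simp [blocksUnion]

theorem blocksUnion_map_blocksUnion (LL : List (List (Finset A))) :
    blocksUnion (LL.map blocksUnion) = blocksUnion LL.flatten := by
  ext a
  simp only [mem_blocksUnion, List.mem_map, List.mem_flatten]
  constructor
  · rintro ⟨_, ⟨l, hl, rfl⟩, ha⟩
    obtain ⟨B, hB, haB⟩ := mem_blocksUnion.1 ha
    exact ⟨B, ⟨l, hl, hB⟩, haB⟩
  · rintro ⟨B, ⟨l, hl, hB⟩, haB⟩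
    exact ⟨_, ⟨l, hl, rfl⟩, mem_blocksUnion.2 ⟨B, hB, haB⟩⟩

theorem isOPart_append {S T : Finset A} {x y : List (Finset A)} (hx : IsOPart S x)
    (hy : IsOPart T y) (h : Disjoint S T) : IsOPart (S ∪ T) (x ++ y) := by
  obtain ⟨hx1, hx2, rfl⟩ := hx
  obtain ⟨hy1, hy2, rfl⟩ := hy
  refine ⟨?_, ?_, ?_⟩
  · intro B hB
    rcases List.mem_append.1 hB with hB | hB
    exacts [hx1 B hB, hy1 B hB]
  · rw [List.pairwise_append]
    refine ⟨hx2, hy2, fun B hB C hC => Finset.disjoint_left.2 fun a haB haC => ?_⟩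
    exact Finset.disjoint_left.1 h (mem_blocksUnion.2 ⟨B, hB, haB⟩)
      (mem_blocksUnion.2 ⟨C, hC, haC⟩)
  · ext a
    simp only [mem_blocksUnion, List.mem_append, Finset.mem_union, or_and_right, exists_or]

theorem isOPart_singleton {B : Finset A} (hB : B.Nonempty) : IsOPart B [B] := by
  refine ⟨?_, by simp, blocksUnion_singleton B⟩
  simpa using hB

/-- The dimension plus the number of blocks is the number of elements. -/
theorem IsOPart.pdim_add_length {S : Finset A} {L : List (Finset A)} (h : IsOPart S L) :
    pdim L + L.length = S.card := by
  induction L generalizing S with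
  | nil =>
    obtain ⟨-, -, rfl⟩ := h
    simp [pdim, blocksUnion]
  | cons B L ih =>
    obtain ⟨h1, h2, rfl⟩ := h
    rw [List.pairwise_cons] at h2
    have hL := ih ⟨fun C hC => h1 C (List.mem_cons_of_mem _ hC), h2.2, rfl⟩
    have hB : 0 < B.card := (h1 B List.mem_cons_self).card_pos
    have hd : Disjoint B (blocksUnion L) := by
      refine Finset.disjoint_left.2 fun a ha ha' => ?_
      obtain ⟨C, hC, haC⟩ := mem_blocksUnion.1 ha'
      exact Finset.disjoint_left.1 (h2.1 C hC) ha haC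
    rw [blocksUnion_cons, Finset.card_union_of_disjoint hd, ← hL]
    simp only [pdim, List.map_cons, List.sum_cons, List.length_cons]
    omega

/-- Uniting consecutive blocks of an ordered partition gives an ordered partition. -/
theorem isOPart_map_blocksUnion {S : Finset A} {LL : List (List (Finset A))}
    (hne : ∀ l ∈ LL, l ≠ []) (h : IsOPart S LL.flatten) :
    IsOPart S (LL.map blocksUnion) := by
  obtain ⟨h1, h2, rfl⟩ := h
  refine ⟨?_, ?_, blocksUnion_map_blocksUnion LL⟩
  · simp only [List.mem_map, forall_exists_index, and_imp, forall_apply_eq_imp_iff₂]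
    intro l hl
    obtain ⟨B, hB⟩ := List.exists_mem_of_ne_nil l (hne l hl)
    obtain ⟨a, ha⟩ := h1 B (List.mem_flatten.2 ⟨l, hl, hB⟩)
    exact ⟨a, mem_blocksUnion.2 ⟨B, hB, ha⟩⟩
  · rw [List.pairwise_flatten] at h2
    rw [List.pairwise_map]
    refine h2.2.imp fun {l l'} hll => Finset.disjoint_left.2 fun a ha ha' => ?_
    obtain ⟨B, hB, haB⟩ := mem_blocksUnion.1 ha
    obtain ⟨C, hC, haC⟩ := mem_blocksUnion.1 ha'
    exact Finset.disjoint_left.1 (hll B hB C hC) haB haC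

theorem flatten_eq_map_blocksUnion {LL : List (List (Finset A))} (hne : ∀ l ∈ LL, l ≠ [])
    (h : LL.flatten.length ≤ LL.length) : LL.flatten = LL.map blocksUnion := by
  induction LL with
  | nil => simp
  | cons l LL ih =>
    have h1 := List.length_pos_iff.2 (hne l List.mem_cons_self)
    have hne' : ∀ l' ∈ LL, l' ≠ [] := fun l' hl' => hne l' (List.mem_cons_of_mem _ hl')
    have h2 := length_le_length_flatten hne'
    simp only [List.flatten_cons, List.length_append, List.length_cons] at h
    obtain ⟨B, rfl⟩ := List.length_eq_one_iff.1 (show l.length = 1 by omega)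
    rw [List.flatten_cons, List.map_cons, ih hne' (by omega), blocksUnion_singleton]
    rfl

/-- A facet of an ordered partition has one more block. -/
theorem PFacet.length_eq {S : Finset A} {x y : List (Finset A)} (h : PFacet x y)
    (hx : IsOPart S x) : x.length = y.length + 1 := by
  obtain ⟨⟨LL, hne, rfl, rfl⟩, -, hdim⟩ := h
  have h1 := hx.pdim_add_length
  have h2 := (isOPart_map_blocksUnion hne hx).pdim_add_length
  omega

/-- A facet of `π|T|ρ` that properly subdivides the block `T` arises by splitting `T` in two. -/
theorem PFacet.exists_split {S T P : Finset A} {x π ρ : List (Finset A)}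
    (h : PFacet x (π ++ [T] ++ ρ)) (hx : IsOPart S x) (hP : P ∈ x) (hPT : P ≠ T)
    (hπ : Disjoint P (blocksUnion π)) (hρ : Disjoint P (blocksUnion ρ)) :
    (x = π ++ [P] ++ [T \ P] ++ ρ) ∨ (x = π ++ [T \ P] ++ [P] ++ ρ) := by
  have hlen := h.length_eq hx
  obtain ⟨⟨LL, hne, rfl, hb⟩, -, -⟩ := h
  obtain ⟨LL', LL2, rfl, hb', rfl⟩ := List.append_eq_map_iff.1 hb
  obtain ⟨LL1, LT, rfl, rfl, hT⟩ := List.append_eq_map_iff.1 hb'.symm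
  obtain ⟨l, rfl, rfl⟩ : ∃ l, LT = [l] ∧ blocksUnion l = T := by
    rcases LT with _ | ⟨l, _ | ⟨l', LT⟩⟩ <;> simp at hT
    exact ⟨l, rfl, hT⟩
  have hne1 : ∀ l ∈ LL1, l ≠ [] := fun l hl => hne l (by simp [hl])
  have hne2 : ∀ l ∈ LL2, l ≠ [] := fun l hl => hne l (by simp [hl])
  have hl0 : l ≠ [] := hne l (by simp)
  have hPne : P.Nonempty := hx.1 P hP
  rw [blocksUnion_map_blocksUnion] at hπ hρ
  have hnot : ∀ M : List (Finset A), Disjoint P (blocksUnion M) → P ∉ M := by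
    intro M hM hPM
    obtain ⟨a, ha⟩ := hPne
    exact Finset.disjoint_left.1 hM ha (mem_blocksUnion.2 ⟨P, hPM, ha⟩)
  have hPl : P ∈ l := by
    simp only [List.flatten_append, List.mem_append, List.flatten_cons, List.flatten_nil,
      List.append_nil] at hP
    rcases hP with (hP | hP) | hP
    exacts [(hnot _ hπ hP).elim, hP, (hnot _ hρ hP).elim]
  have hl2 : 2 ≤ l.length := by
    by_contra hlt
    have := List.length_pos_iff.2 hl0
    obtain ⟨B, rfl⟩ := List.length_eq_one_iff.1 (show l.length = 1 by omega)
    rw [List.mem_singleton] at hPl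
    exact hPT (by rw [hPl, blocksUnion_singleton])
  have h1 := length_le_length_flatten hne1
  have h2 := length_le_length_flatten hne2
  simp only [List.flatten_append, List.flatten_cons, List.flatten_nil, List.append_nil,
    List.length_append, List.length_map, List.length_cons, List.length_nil] at hlen
  obtain ⟨X, Y, rfl⟩ := List.length_eq_two.1 (show l.length = 2 by omega)
  have hd : Disjoint X Y := by
    have := (List.pairwise_flatten.1 hx.2.1).1 [X, Y] (by simp)
    simpa using this
  have hU : blocksUnion [X, Y] = X ∪ Y := by simp [blocksUnion]
  simp only [List.flatten_append, List.flatten_cons, List.flatten_nil, List.append_nil, hU,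
    flatten_eq_map_blocksUnion hne1 (by omega), flatten_eq_map_blocksUnion hne2 (by omega)]
  simp only [List.mem_cons, List.not_mem_nil, or_false] at hPl
  rcases hPl with rfl | rfl
  · left
    rw [Finset.union_sdiff_cancel_left hd]
    simp
  · right
    rw [Finset.union_sdiff_cancel_right hd]
    simp

/-- A facet of `y|{m}` has the form `x|{m}` with `x` a facet of `y`. -/
theorem PFacet.exists_append_singleton {S : Finset A} {m : A} {z y : List (Finset A)}
    (h : PFacet z (y ++ [{m}])) (hz : IsOPart S z) :
    ∃ x, z = x ++ [{m}] ∧ PFacet x y := by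
  obtain ⟨⟨LL, hne, rfl, hb⟩, hneq, hdim⟩ := h
  obtain ⟨LL1, LT, rfl, rfl, hT⟩ := List.append_eq_map_iff.1 hb
  obtain ⟨l, rfl, hl⟩ : ∃ l, LT = [l] ∧ blocksUnion l = {m} := by
    rcases LT with _ | ⟨l, _ | ⟨l', LT⟩⟩ <;> simp at hT
    exact ⟨l, rfl, hT⟩
  have hl0 : l ≠ [] := hne l (by simp)
  have hsing : ∀ B ∈ l, B = {m} := by
    intro B hB
    have hBne : B.Nonempty := hz.1 B (by simp [hB])
    refine hBne.subset_singleton_iff.1 fun a ha => ?_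
    rw [← hl]
    exact mem_blocksUnion.2 ⟨B, hB, ha⟩
  have hpw := (List.pairwise_flatten.1 hz.2.1).1 l (by simp)
  have hl1 : l = [{m}] := by
    rcases l with _ | ⟨X, _ | ⟨Y, l⟩⟩
    · exact (hl0 rfl).elim
    · rw [hsing X (by simp)]
    · have hX := hsing X (by simp)
      have hY := hsing Y (by simp)
      subst hX hY
      simp at hpw
  subst hl1
  refine ⟨LL1.flatten, by simp, ⟨LL1, fun l hl => hne l (by simp [hl]), rfl, rfl⟩, ?_, ?_⟩
  · intro he
    apply hneq
    simp [he]
  · simpa [pdim] using hdim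

end BlocksUnion

section MemVFacts

variable {A : Type*} [LinearOrder A]

theorem isOPart_of_memV {S : Finset A} {x y : List (Finset A)} (h : memV S x y) :
    IsOPart S x := by
  induction h with
  | mstep S hS x y _ ih =>
    have := isOPart_append ih (isOPart_singleton (Finset.singleton_nonempty (S.max' hS)))
      (by simp)
    rwa [Finset.union_comm, ← Finset.insert_eq, Finset.insert_erase (S.max'_mem hS)] at this
  | rstep S hS C B D π ρ hB hCB hCD hBD hU hπ hρ =>
    have hm : S.max' hS ∉ C ∪ B ∪ D := by simp [hU]
    simp only [Finset.mem_union, not_or] at hm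
    have := isOPart_append (isOPart_append (isOPart_append hπ
      (isOPart_singleton (Finset.singleton_nonempty (S.max' hS))) (by simpa using hm.1.1))
      (isOPart_singleton hB) (by simp [hCB, hm.1.2]))
      hρ (by simp [hCD, hBD, hm.2])
    convert this using 1
    have hins := Finset.insert_erase (S.max'_mem hS)
    rw [← hU] at hins
    refine hins.symm.trans ?_
    ext a
    simp only [Finset.mem_insert, Finset.mem_union, Finset.mem_singleton]
    tauto

theorem singleton_max'_mem_of_memV {S : Finset A} {x y : List (Finset A)} (hS : S.Nonempty)
    (h : memV S x y) : {S.max' hS} ∈ x := by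
  cases h <;> simp

/-- A cell `x|{max S}` that is matched upwards comes from a cell `x` matched upwards. -/
theorem exists_memV_erase {S : Finset A} (hS : S.Nonempty) {x z : List (Finset A)}
    (h : memV S (x ++ [{S.max' hS}]) z) : ∃ y, memV (S.erase (S.max' hS)) x y := by
  generalize hw : x ++ [{S.max' hS}] = w at h
  cases h with
  | mstep _ _ x' y' h' =>
    obtain rfl := List.append_cancel_right hw
    exact ⟨_, h'⟩
  | rstep _ _ C B D π ρ hB hCB hCD hBD hU hπ hρ =>
    exfalso
    have hm : S.max' hS ∉ C ∪ B ∪ D := by simp [hU]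
    simp only [Finset.mem_union, not_or] at hm
    rcases List.eq_nil_or_concat ρ with rfl | ⟨ρ', E, rfl⟩
    · have hBm : {S.max' hS} = B := by simpa using congrArg List.getLast? hw
      exact hm.1.2 (by simp [← hBm])
    · have hEm : {S.max' hS} = E := by
        simpa [List.getLast?_cons] using congrArg List.getLast? hw
      apply hm.2
      rw [← hρ.2.2]
      exact mem_blocksUnion.2 ⟨E, by simp, by simp [← hEm]⟩

/-- There is a function that strictly increases along every step of a gradient path. -/
theorem exists_rank_of_memV (S : Finset A) :
    ∃ Φ : List (Finset A) → ℕ, ∀ a b a' b', memV S a b → memV S a' b' → ¬ memV S a' b →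
      PFacet a' b → Φ a < Φ a' := by
  induction S using Finset.strongInduction with
  | H S ih =>
    rcases S.eq_empty_or_nonempty with rfl | hS
    · refine ⟨fun _ => 0, fun a b a' b' h => ?_⟩
      cases h with
      | mstep _ hS => simp at hS
      | rstep _ hS => simp at hS
    obtain ⟨Φ, hΦ⟩ := ih _ (Finset.erase_ssubset (S.max'_mem hS))
    refine ⟨fun l => if l.getLast? = some {S.max' hS} then S.card + Φ l.dropLast
      else l.idxOf {S.max' hS}, fun a b a' b' h h' hn hf => ?_⟩
    have ha' := isOPart_of_memV h'
    have hpart := isOPart_of_memV h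
    cases h with
    | mstep _ _ x y hxy =>
      obtain ⟨x', rfl, hf'⟩ := hf.exists_append_singleton ha'
      obtain ⟨y', hy'⟩ := exists_memV_erase hS h'
      have := hΦ x y x' y' hxy hy' (fun hc => hn (memV.mstep S hS _ _ hc)) hf'
      simpa using this
    | rstep _ _ C B D π ρ hB hCB hCD hBD hU hπ hρ =>
      have hm : S.max' hS ∉ C ∪ B ∪ D := by simp [hU]
      simp only [Finset.mem_union, not_or] at hm
      obtain ⟨⟨hmC, hmB⟩, hmD⟩ := hm
      have hnot : ∀ {T : Finset A} {L : List (Finset A)}, IsOPart T L → S.max' hS ∉ T →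
          {S.max' hS} ∉ L := fun hL hT hmem =>
        hT (hL.2.2 ▸ mem_blocksUnion.2 ⟨_, hmem, Finset.mem_singleton_self _⟩)
      have hmπ := hnot hπ hmC
      have hmρ := hnot hρ hmD
      have hBm : B ≠ {S.max' hS} := by
        rintro rfl
        simp at hmB
      have hlast : (π ++ [{S.max' hS}] ++ [B] ++ ρ).getLast? ≠ some {S.max' hS} := by
        rcases List.eq_nil_or_concat ρ with rfl | ⟨ρ', E, rfl⟩
        · simpa using hBm
        · intro hE
          apply hmρ
          simp [List.getLast?_cons] at hE
          simp [hE]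
      have hidx : (π ++ [{S.max' hS}] ++ [B] ++ ρ).idxOf {S.max' hS} = π.length := by
        simp [List.idxOf_append, hmπ]
      have hcard := hpart.pdim_add_length
      simp only [List.length_append, List.length_singleton] at hcard
      have hsplit : insert (S.max' hS) B \ {S.max' hS} = B := by
        rw [Finset.sdiff_singleton_eq_erase, Finset.erase_insert hmB]
      have hne : ({S.max' hS} : Finset A) ≠ insert (S.max' hS) B := by
        intro he
        rw [← he] at hsplit
        simp [← hsplit] at hB
      have := hf.exists_split ha' (singleton_max'_mem_of_memV hS h') hne
        (by simpa [hπ.2.2] using hmC) (by simpa [hρ.2.2] using hmD)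
      rw [hsplit] at this
      rcases this with rfl | rfl
      · exact (hn (memV.rstep S hS C B D π ρ hB hCB hCD hBD hU hπ hρ)).elim
      · have hidx' : (π ++ [B] ++ [{S.max' hS}] ++ ρ).idxOf {S.max' hS} = π.length + 1 := by
          have : {S.max' hS} ∉ π ++ [B] := by
            simp [hmπ, hBm.symm]
          rw [List.append_assoc, List.idxOf_append_of_notMem this]
          simp
        simp only [if_neg hlast, hidx, hidx']
        split_ifs <;> omega

end MemVFacts

/-- For every finite linearly ordered set `A`, the discrete vector
field `V_A` is a gradient field on the poset `P_A` of ordered partitions of `A`. -/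
theorem stmt_8 {A : Type*} [LinearOrder A] [Fintype A] :
    PGradient {p : List (Finset A) × List (Finset A) | memV Finset.univ p.1 p.2} := by
  rintro k a b ⟨hk, hcyc, hstep⟩
  obtain ⟨Φ, hΦ⟩ := exists_rank_of_memV (Finset.univ : Finset A)
  have hup : ∀ i, ∃ c, memV Finset.univ (a i) c := by
    intro i
    induction i using Fin.lastCases with
    | last => exact ⟨_, hcyc ▸ (hstep ⟨0, hk⟩).1⟩
    | cast i => exact ⟨_, (hstep i).1⟩
  have hmono : StrictMono fun i => Φ (a i) := by
    refine Fin.strictMono_iff_lt_succ.2 fun i => ?_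
    obtain ⟨c, hc⟩ := hup i.succ
    exact hΦ _ _ _ _ (hstep i).1 hc (hstep i).2.1 (hstep i).2.2
  have hlt : Φ (a 0) < Φ (a (Fin.last k)) := hmono (Fin.lt_def.2 (by simpa using hk))
  rw [hcyc] at hlt
  exact lt_irrefl _ hlt
end
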